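/- There is no continuous retraction r : Dⁿ → Sⁿ⁻¹, i.e., no continuous map from the closed n-disk to its boundary sphere restricting to the identity on Sⁿ⁻¹ (Brouwer's no-retraction theorem). -/

import Mathlib

open Metric MeasureTheory in
theorem nr_det_interp {E : Type*} [NormedAddCommGroup E] [InnerProductSpace ℝ E]
    [FiniteDimensional ℝ E] (s : Finset ℝ) (hs : s.card = Module.finrank ℝ E + 1)
    (A : E →L[ℝ] E) :
    (1 + A).det = ∑ t ∈ s, (1 + t • A).det * (Lagrange.basis s id t).eval 1 := by
  classical
  let b := Module.finBasis ℝ E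
  let M := LinearMap.toMatrix b b (A : E →ₗ[ℝ] E)
  let p : Polynomial ℝ :=
    ((Polynomial.X : Polynomial ℝ) • M.map (Polynomial.C : ℝ →+* Polynomial ℝ) + (1 : Matrix (Fin (Module.finrank ℝ E)) (Fin (Module.finrank ℝ E)) ℝ).map (Polynomial.C : ℝ →+* Polynomial ℝ)).det
  have hp : ∀ t : ℝ, p.eval t = (1 + t • A).det := by
    intro t
    have h1 : (1 + t • A).det = (1 + t • M).det := by
      rw [ContinuousLinearMap.det, ← LinearMap.det_toMatrix b]
      congr 1
      have : ((1 + t • A : E →L[ℝ] E) : E →ₗ[ℝ] E) = 1 + t • (A : E →ₗ[ℝ] E) := rfl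
      rw [this, map_add, map_smul, LinearMap.toMatrix_one]
    rw [h1]
    have h2 : p.eval t = (Polynomial.evalRingHom t) p := rfl
    rw [h2, RingHom.map_det]
    congr 1
    ext i j
    by_cases hij : i = j
    · subst hij; simp; ring
    · simp [hij]; ring
  have hd : p.degree < s.card := by
    refine lt_of_le_of_lt Polynomial.degree_le_natDegree ?_
    have := Polynomial.natDegree_det_X_add_C_le M 1
    rw [Fintype.card_fin] at this
    rw [hs]
    exact_mod_cast Nat.lt_succ_of_le this
  have hi := Lagrange.eq_interpolate (s := s) (v := id) (f := p)
    (Function.injective_id.injOn) hd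
  have := hp 1
  rw [one_smul] at this
  rw [← this]
  conv_lhs => rw [hi]
  rw [Lagrange.interpolate_apply, Polynomial.eval_finsetSum]
  refine Finset.sum_congr rfl fun t _ => ?_
  simp [hp]

theorem nr_det_pos {E : Type*} [NormedAddCommGroup E] [InnerProductSpace ℝ E]
    [FiniteDimensional ℝ E] (A : E →L[ℝ] E) (hA : ‖A‖ < 1) : 0 < (1 + A).det := by
  have hne : ∀ u ∈ Set.Icc (0 : ℝ) 1, (1 + u • A).det ≠ 0 := by
    intro u hu
    have h1 : ‖-(u • A)‖ < 1 := by
      rw [norm_neg, norm_smul, Real.norm_of_nonneg hu.1]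
      nlinarith [norm_nonneg A, hu.1, hu.2]
    have h2 : IsUnit (1 + u • A) := by
      have := isUnit_one_sub_of_norm_lt_one h1
      rwa [sub_neg_eq_add] at this
    have h3 : IsUnit ((1 + u • A : E →L[ℝ] E) : E →ₗ[ℝ] E) :=
      h2.map (ContinuousLinearMap.toLinearMapRingHom : (E →L[ℝ] E) →+* (E →ₗ[ℝ] E))
    exact (LinearMap.isUnit_det _ h3).ne_zero
  have hc : ContinuousOn (fun u : ℝ => (1 + u • A).det) (Set.Icc 0 1) := by
    have : Continuous fun u : ℝ => (1 + u • A).det :=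
      ContinuousLinearMap.continuous_det.comp (by fun_prop)
    exact this.continuousOn
  by_contra hle
  push Not at hle
  have h0 : (1 + (0 : ℝ) • A).det = 1 := by
    rw [zero_smul, add_zero]
    exact LinearMap.det_id
  have := intermediate_value_Icc' zero_le_one hc
  obtain ⟨u, hu, hu0⟩ := this (show (0 : ℝ) ∈ _ by
    constructor
    · simpa using hle
    · simp only [h0]; exact zero_le_one)
  exact hne u hu hu0

open Metric MeasureTheory in
theorem nr_small {E : Type*} [NormedAddCommGroup E] [InnerProductSpace ℝ E]
    [FiniteDimensional ℝ E] [MeasurableSpace E] [BorelSpace E]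
    (r : E → E) (hr : ContDiff ℝ 1 r) (hr1 : ∀ x, ‖r x‖ = 1) (hrs : ∀ x, ‖x‖ = 1 → r x = x) :
    ∃ δ > 0, ∀ t : ℝ, 0 < t → t < δ →
      ∫ x in closedBall (0 : E) 1, (1 + t • fderiv ℝ (fun x => r x - x) x).det
        = (volume : Measure E).real (closedBall 0 1) := by
  set h : E → E := fun x => r x - x with hh
  have hC : ContDiff ℝ 1 h := hr.sub contDiff_id
  have hcd : Continuous (fderiv ℝ h) := hC.continuous_fderiv one_ne_zero
  obtain ⟨K0, hK0⟩ := (isCompact_closedBall (0 : E) 1).exists_bound_of_continuousOn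
    hcd.continuousOn
  set K : ℝ := max K0 0 with hK
  have hKn : 0 ≤ K := le_max_right _ _
  have hKb : ∀ x ∈ closedBall (0 : E) 1, ‖fderiv ℝ h x‖ ≤ K :=
    fun x hx => (hK0 x hx).trans (le_max_left _ _)
  have hlip : ∀ x ∈ closedBall (0 : E) 1, ∀ y ∈ closedBall (0 : E) 1,
      ‖h y - h x‖ ≤ K * ‖y - x‖ := by
    intro x hx y hy
    exact (convex_closedBall (0 : E) 1).norm_image_sub_le_of_norm_fderiv_le
      (fun z _ => (hC.differentiable one_ne_zero) z) hKb hx hy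
  have hhs : ∀ x, ‖x‖ = 1 → h x = 0 := fun x hx => by simp [hh, hrs x hx]
  refine ⟨min 1 (1 / (2 * K + 1)), by positivity, fun t ht0 htd => ?_⟩
  have ht1 : t < 1 := htd.trans_le (min_le_left _ _)
  have htK : 2 * K * t + t < 1 := by
    have := htd.trans_le (min_le_right _ _)
    rw [lt_div_iff₀ (by positivity)] at this
    linarith
  have htK' : t * K < 1 := by nlinarith
  set f : E → E := fun x => x + t • h x with hf
  have hfd : ∀ x, HasFDerivAt f (1 + t • fderiv ℝ h x) x := fun x =>
    (hasFDerivAt_id x).add (((hC.differentiable one_ne_zero) x).hasFDerivAt.const_smul t)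
  have hinj : Set.InjOn f (closedBall 0 1) := by
    intro x hx y hy hxy
    have h1 : x - y = t • (h y - h x) := by
      have hxy : x + t • h x = y + t • h y := hxy
      rw [smul_sub]
      rw [show x - y = x + t • h x - y - t • h x by abel, hxy]; abel
    have h2 : ‖x - y‖ ≤ t * (K * ‖x - y‖) := by
      conv_lhs => rw [h1]
      rw [norm_smul, Real.norm_of_nonneg ht0.le, norm_sub_rev x y]
      exact mul_le_mul_of_nonneg_left (hlip x hx y hy) ht0.le
    have h3 : ‖x - y‖ = 0 := by
      have := norm_nonneg (x - y)
      nlinarith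
    exact sub_eq_zero.1 (norm_eq_zero.1 h3)
  have himg : f '' closedBall 0 1 = closedBall 0 1 := by
    apply Set.Subset.antisymm
    · rintro _ ⟨x, hx, rfl⟩
      rw [mem_closedBall_zero_iff] at hx ⊢
      have : f x = (1 - t) • x + t • r x := by
        simp only [hf, hh, smul_sub, sub_smul, one_smul]; abel
      rw [this]
      refine (norm_add_le _ _).trans ?_
      rw [norm_smul, norm_smul, hr1, Real.norm_of_nonneg ht0.le,
        Real.norm_of_nonneg (by linarith)]
      nlinarith
    · intro y hy
      classical
      let g : E → E := fun x => if ‖x‖ ≤ 1 then h x else 0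
      have key : ∀ x y : E, ‖x‖ ≤ 1 → ¬ ‖y‖ ≤ 1 → ‖h x‖ ≤ 2 * K * ‖x - y‖ := by
        intro x y hx hy
        push Not at hy
        have hy0 : 0 < ‖y‖ := by linarith
        have hz : ‖(‖y‖⁻¹ • y)‖ = 1 := by
          rw [norm_smul, norm_inv, norm_norm, inv_mul_cancel₀ hy0.ne']
        have h1 := hlip (‖y‖⁻¹ • y) (by rw [mem_closedBall_zero_iff, hz]) x
          (by rwa [mem_closedBall_zero_iff])
        rw [hhs _ hz, sub_zero] at h1
        have h2 : ‖y - ‖y‖⁻¹ • y‖ = ‖y‖ - 1 := by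
          have : y - ‖y‖⁻¹ • y = (1 - ‖y‖⁻¹) • y := by rw [sub_smul, one_smul]
          rw [this, norm_smul, Real.norm_of_nonneg]
          · field_simp
          · have := inv_le_one_of_one_le₀ hy.le
            linarith
        have h3 : ‖x - ‖y‖⁻¹ • y‖ ≤ ‖x - y‖ + ‖y - ‖y‖⁻¹ • y‖ := norm_sub_le_norm_sub_add_norm_sub _ _ _
        have h4 : ‖y‖ - ‖x‖ ≤ ‖x - y‖ := by
          rw [norm_sub_rev]; exact norm_sub_norm_le y x
        have h5 : ‖x - ‖y‖⁻¹ • y‖ ≤ 2 * ‖x - y‖ := by linarith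
        calc _ ≤ _ := h1
          _ ≤ K * (2 * ‖x - y‖) := mul_le_mul_of_nonneg_left h5 hKn
          _ = _ := by ring
      have hg : ∀ x y, ‖g x - g y‖ ≤ 2 * K * ‖x - y‖ := by
        intro x y
        by_cases hx : ‖x‖ ≤ 1 <;> by_cases hy : ‖y‖ ≤ 1
        · simp only [g, hx, hy, if_true]
          have := hlip y (by rwa [mem_closedBall_zero_iff]) x (by rwa [mem_closedBall_zero_iff])
          have h2 : 0 ≤ K * ‖x - y‖ := by positivity
          linarith
        · simp only [g, hx, hy, if_true, if_false, sub_zero]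
          exact key x y hx hy
        · simp only [g, hx, hy, if_true, if_false, zero_sub, norm_neg]
          rw [norm_sub_rev x y]
          exact key y x hy hx
        · simp only [g, hx, hy, if_false, sub_zero, norm_zero]
          positivity
      have hcon : ContractingWith (Real.toNNReal (2 * K * t)) (fun x => y - t • g x) := by
        constructor
        · rw [Real.toNNReal_lt_one]; linarith
        · apply LipschitzWith.of_dist_le_mul
          intro a b
          rw [Real.coe_toNNReal _ (by positivity), dist_eq_norm, dist_eq_norm]
          have : y - t • g a - (y - t • g b) = t • (g b - g a) := by
            rw [smul_sub]; abel
          rw [this, norm_smul, Real.norm_of_nonneg ht0.le, norm_sub_rev a b]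
          calc _ ≤ t * (2 * K * ‖b - a‖) := mul_le_mul_of_nonneg_left (hg b a) ht0.le
            _ = _ := by ring
      have hfix := hcon.fixedPoint_isFixedPt
      set x := ContractingWith.fixedPoint _ hcon
      have hx : y - t • g x = x := hfix
      have hx1 : ‖x‖ ≤ 1 := by
        by_contra hcx
        simp only [g, hcx, if_false, smul_zero, sub_zero] at hx
        rw [mem_closedBall_zero_iff, hx] at hy
        exact hcx hy
      refine ⟨x, by rwa [mem_closedBall_zero_iff], ?_⟩
      simp only [g, hx1, if_true] at hx
      simp only [hf]
      nth_rewrite 1 [← hx]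
      abel
  have hcv := integral_image_eq_integral_abs_det_fderiv_smul (volume : Measure E)
    (measurableSet_closedBall) (fun x _ => (hfd x).hasFDerivWithinAt) hinj (fun _ => (1 : ℝ))
  rw [himg] at hcv
  have : ∫ x in closedBall (0 : E) 1, (1 + t • fderiv ℝ h x).det
      = ∫ x in closedBall (0 : E) 1, |(1 + t • fderiv ℝ h x).det| • (1 : ℝ) := by
    refine setIntegral_congr_fun measurableSet_closedBall fun x hx => ?_
    simp only [smul_eq_mul, mul_one]
    rw [abs_of_pos]
    apply nr_det_pos
    rw [norm_smul, Real.norm_of_nonneg ht0.le]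
    exact (mul_le_mul_of_nonneg_left (hKb x hx) ht0.le).trans_lt htK'
  rw [this, ← hcv]
  simp

open Metric MeasureTheory in
theorem nr_smooth {E : Type*} [NormedAddCommGroup E] [InnerProductSpace ℝ E]
    [FiniteDimensional ℝ E]
    (r : E → E) (hr : ContDiff ℝ 1 r) (hr1 : ∀ x, ‖r x‖ = 1) (hrs : ∀ x, ‖x‖ = 1 → r x = x) :
    False := by
  let : MeasurableSpace E := borel E
  have : BorelSpace E := ⟨rfl⟩
  obtain ⟨δ, hδ, H⟩ := nr_small r hr hr1 hrs
  obtain ⟨s, hsub, hs⟩ := (Set.Ioo_infinite hδ).exists_subset_card_eq (Module.finrank ℝ E + 1)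
  set h : E → E := fun x => r x - x with hh
  have hC : ContDiff ℝ 1 h := hr.sub contDiff_id
  have hcd : Continuous (fderiv ℝ h) := hC.continuous_fderiv one_ne_zero
  have hzero : ∀ x, (1 + fderiv ℝ h x).det = 0 := by
    intro x
    have hd : HasFDerivAt r (fderiv ℝ r x) x :=
      ((hr.differentiable one_ne_zero) x).hasFDerivAt
    have h1 : 1 + fderiv ℝ h x = fderiv ℝ r x := by
      have : fderiv ℝ h x = fderiv ℝ r x - 1 := (hd.sub (hasFDerivAt_id x)).fderiv
      rw [this]; abel
    rw [h1]
    have horth : ∀ v, inner ℝ (r x) (fderiv ℝ r x v) = 0 := by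
      intro v
      have h2 := hd.norm_sq
      have h3 : (fun y => ‖r y‖ ^ 2) = fun _ => (1 : ℝ) := by
        funext y; simp [hr1]
      rw [h3] at h2
      have h4 := h2.unique (hasFDerivAt_const (1 : ℝ) x)
      have h5 := congrArg (fun L => L v) h4
      simpa using h5
    by_contra hne
    have hu : IsUnit (LinearMap.det (fderiv ℝ r x : E →ₗ[ℝ] E)) := isUnit_iff_ne_zero.2 hne
    have hsurj : Function.Surjective (fderiv ℝ r x : E →ₗ[ℝ] E) :=
      ((Module.End.isUnit_iff _).1 ((LinearMap.isUnit_iff_isUnit_det _).2 hu)).surjective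
    obtain ⟨v, hv⟩ := hsurj (r x)
    have h6 := horth v
    have hv' : fderiv ℝ r x v = r x := hv
    rw [hv', real_inner_self_eq_norm_sq, hr1] at h6
    norm_num at h6
  have hint : ∀ t : ℝ, IntegrableOn (fun x => (1 + t • fderiv ℝ h x).det)
      (closedBall (0 : E) 1) := by
    intro t
    have : Continuous fun x => (1 + t • fderiv ℝ h x).det :=
      ContinuousLinearMap.continuous_det.comp (by fun_prop)
    exact this.continuousOn.integrableOn_compact (isCompact_closedBall _ _)
  have e1 : ∫ x in closedBall (0 : E) 1, (1 + fderiv ℝ h x).det = 0 := by simp [hzero]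
  have e2 : ∫ x in closedBall (0 : E) 1, (1 + fderiv ℝ h x).det
      = ∑ t ∈ s, (volume : Measure E).real (closedBall 0 1) * (Lagrange.basis s id t).eval 1 := by
    rw [show (fun x => (1 + fderiv ℝ h x).det) = fun x => ∑ t ∈ s,
      (1 + t • fderiv ℝ h x).det * (Lagrange.basis s id t).eval 1 from
      funext fun x => nr_det_interp s hs _]
    rw [integral_finsetSum]
    · refine Finset.sum_congr rfl fun t ht => ?_
      rw [integral_mul_const, H t (hsub ht).1 (hsub ht).2]
    · intro t _
      exact (hint t).mul_const _
  rw [e1, ← Finset.mul_sum, ← Polynomial.eval_finsetSum, Lagrange.sum_basis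
    Function.injective_id.injOn (Finset.card_pos.1 (by omega))] at e2
  have hpos : 0 < (volume : Measure E).real (closedBall 0 1) :=
    ENNReal.toReal_pos (measure_closedBall_pos _ _ one_pos).ne'
      (isCompact_closedBall _ _).measure_lt_top.ne
  simp at e2
  linarith

open Metric in
theorem no_retraction_disk_to_sphere_aux {E : Type*} [NormedAddCommGroup E]
    [InnerProductSpace ℝ E] [FiniteDimensional ℝ E]
    (r : C(↥(closedBall (0 : E) 1), ↥(sphere (0 : E) 1)))
    (hr : ∀ x : ↥(sphere (0 : E) 1), r ⟨x.1, sphere_subset_closedBall x.2⟩ = x) : False := by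
  have hρ : ∀ x : E, (max 1 ‖(2 : ℝ) • x‖)⁻¹ • ((2 : ℝ) • x) ∈ closedBall (0 : E) 1 := by
    intro x
    have hm : 0 < max 1 ‖(2 : ℝ) • x‖ := lt_of_lt_of_le one_pos (le_max_left _ _)
    rw [mem_closedBall_zero_iff, norm_smul, norm_inv, Real.norm_of_nonneg hm.le,
      inv_mul_le_iff₀ hm, mul_one]
    exact le_max_right _ _
  let G : E → E := fun x => (r ⟨_, hρ x⟩ : E)
  have hGc : Continuous G := by
    refine continuous_subtype_val.comp (r.continuous.comp (Continuous.subtype_mk ?_ _))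
    refine Continuous.smul (Continuous.inv₀ (by fun_prop) fun x => ?_) (by fun_prop)
    exact (lt_of_lt_of_le one_pos (le_max_left _ _)).ne'
  have hG1 : ∀ x, ‖G x‖ = 1 := fun x => by
    have := (r ⟨_, hρ x⟩).2
    rwa [mem_sphere_zero_iff_norm] at this
  have hGx : ∀ x, 1 / 2 ≤ ‖x‖ → G x = ‖x‖⁻¹ • x := by
    intro x hx
    have hx0 : 0 < ‖x‖ := by linarith
    have h2 : ‖(2 : ℝ) • x‖ = 2 * ‖x‖ := by rw [norm_smul]; norm_num
    have h3 : (max 1 ‖(2 : ℝ) • x‖)⁻¹ • ((2 : ℝ) • x) = ‖x‖⁻¹ • x := by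
      rw [h2, max_eq_right (by linarith), smul_smul]
      congr 1
      field_simp
    have h4 : ‖x‖⁻¹ • x ∈ sphere (0 : E) 1 := by
      rw [mem_sphere_zero_iff_norm, norm_smul, norm_inv, norm_norm, inv_mul_cancel₀ hx0.ne']
    have h5 := congrArg Subtype.val (hr ⟨_, h4⟩)
    simp only [G, h3]
    exact h5
  obtain ⟨P, hPc, hP, -⟩ := hGc.exists_contDiff_approx 1 (ε := fun _ => 1 / 2)
    continuous_const (fun _ => by norm_num)
  let b : ContDiffBump (0 : E) := ⟨1 / 2, 1, by norm_num, by norm_num⟩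
  let F : E → E := fun x => b x • P x + (1 - b x) • x
  have hbc : ContDiff ℝ 1 b := b.contDiff (n := 1)
  have hF : ContDiff ℝ 1 F :=
    (hbc.smul hPc).add ((contDiff_const.sub hbc).smul contDiff_id)
  have hPn : ∀ x, ‖P x - G x‖ < 1 / 2 := fun x => by
    rw [← dist_eq_norm]; exact hP x
  have hF0 : ∀ x, F x ≠ 0 := by
    intro x hx
    by_cases hn : ‖x‖ ≤ 1 / 2
    · have hb : b x = 1 := b.one_of_mem_closedBall (by rwa [mem_closedBall_zero_iff])
      simp only [F, hb, one_smul, sub_self, zero_smul, add_zero] at hx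
      have := hPn x
      rw [hx, zero_sub, norm_neg, hG1] at this
      norm_num at this
    · push Not at hn
      have hx0 : 0 < ‖x‖ := by linarith
      have h1 : inner ℝ x (P x) ≥ ‖x‖ / 2 := by
        have e : inner ℝ x (P x) = inner ℝ x (G x) + inner ℝ x (P x - G x) := by
          rw [← inner_add_right]; congr 1; abel
        have e1 : inner ℝ x (G x) = ‖x‖ := by
          rw [hGx x hn.le, inner_smul_right, real_inner_self_eq_norm_sq]
          field_simp
        have e2 := neg_le_of_abs_le (abs_real_inner_le_norm x (P x - G x))
        have e3 := mul_le_mul_of_nonneg_left (hPn x).le hx0.le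
        linarith
      have h2 : inner ℝ x (F x) = b x * inner ℝ x (P x) + (1 - b x) * ‖x‖ ^ 2 := by
        simp only [F]
        rw [inner_add_right, inner_smul_right, inner_smul_right, real_inner_self_eq_norm_sq]
      rw [hx, inner_zero_right] at h2
      have hb0 : 0 ≤ b x := b.nonneg
      have hb1 : b x ≤ 1 := b.le_one
      have h3 : 0 < inner ℝ x (P x) := by linarith
      have h4 : 0 < ‖x‖ ^ 2 := by positivity
      rcases hb0.eq_or_lt with hb | hb
      · rw [← hb] at h2; linarith
      · have : 0 < b x * inner ℝ x (P x) := mul_pos hb h3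
        have : 0 ≤ (1 - b x) * ‖x‖ ^ 2 := mul_nonneg (by linarith) h4.le
        linarith
  refine nr_smooth (fun x => ‖F x‖⁻¹ • F x) ?_ ?_ ?_
  · exact ((hF.norm ℝ hF0).inv fun x => norm_ne_zero_iff.2 (hF0 x)).smul hF
  · intro x
    rw [norm_smul, norm_inv, norm_norm, inv_mul_cancel₀ (norm_ne_zero_iff.2 (hF0 x))]
  · intro x hx
    have hb : b x = 0 := b.zero_of_le_dist (by simp [b, hx])
    simp [F, hb, hx]

/-- Brouwer's no-retraction theorem: there is no continuous retraction of the
closed `n`-disk onto its boundary sphere. -/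
theorem no_retraction_disk_to_sphere (n : ℕ) (hn : 1 ≤ n) :
    ¬ ∃ r : C(↥(Metric.closedBall (0 : EuclideanSpace ℝ (Fin n)) 1),
              ↥(Metric.sphere (0 : EuclideanSpace ℝ (Fin n)) 1)),
        ∀ x : ↥(Metric.sphere (0 : EuclideanSpace ℝ (Fin n)) 1),
          r ⟨x.1, Metric.sphere_subset_closedBall x.2⟩ = x := by
  rintro ⟨r, hr⟩
  exact no_retraction_disk_to_sphere_aux r hr
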